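/- Let m ≥ 2 be a natural number and let k_m := Γ(m/2)/(√π · Γ((m−1)/2)). Let μ be the measure on ℝ with density θ ↦ k_m · (sin θ)^{m−2} · 1_{[0,π]}(θ) with respect to Lebesgue measure. Then the pushforward of μ under the map θ ↦ cos θ is the measure on ℝ with density y ↦ k_m · (1 − y²)^{(m−3)/2} · 1_{[−1,1]}(y) with respect to Lebesgue measure (the power (1−y²)^{(m−3)/2} taken as a real power). -/

import Mathlib

open Real MeasureTheory

/-- The pushforward under `cos` of a density `f` on `[0, π]` has density `g` on `[-1, 1]`, provided
`f θ = sin θ * g (cos θ)` on the open interval. -/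
lemma map_cos_withDensity_indicator {f g : ℝ → ENNReal}
    (hfg : ∀ θ ∈ Set.Ioo 0 π, f θ = ENNReal.ofReal (Real.sin θ) * g (Real.cos θ)) :
    Measure.map Real.cos (volume.withDensity (Set.indicator (Set.Icc 0 π) f))
      = volume.withDensity (Set.indicator (Set.Icc (-1) 1) g) := by
  ext B hB
  have hB' : MeasurableSet (Real.cos ⁻¹' B) := Real.measurable_cos hB
  rw [Measure.map_apply Real.measurable_cos hB, withDensity_apply _ hB', withDensity_apply _ hB,
    ← lintegral_indicator hB', ← lintegral_indicator hB, Set.indicator_indicator,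
    Set.indicator_indicator, Set.inter_comm, Set.inter_comm B, ← Set.indicator_indicator,
    ← Set.indicator_indicator, lintegral_indicator measurableSet_Icc,
    lintegral_indicator measurableSet_Icc, ← Real.bijOn_cos.image_eq,
    lintegral_image_eq_lintegral_deriv_mul_of_antitoneOn measurableSet_Icc
      (fun θ _ => (Real.hasDerivAt_cos θ).hasDerivWithinAt) Real.antitoneOn_cos,
    ← setLIntegral_congr Ioo_ae_eq_Icc, ← setLIntegral_congr Ioo_ae_eq_Icc]
  refine setLIntegral_congr_fun measurableSet_Ioo fun θ hθ => ?_
  by_cases h : Real.cos θ ∈ B <;> simp [Set.indicator, h, hfg θ hθ]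

lemma sin_pow_eq_sin_mul_rpow {m : ℕ} (hm : 2 ≤ m) {θ : ℝ} (hθ : 0 < Real.sin θ) :
    Real.sin θ ^ (m - 2) = Real.sin θ * (1 - Real.cos θ ^ 2) ^ (((m : ℝ) - 3) / 2) := by
  rw [← Real.sin_sq, ← Real.rpow_natCast_mul hθ.le, ← Real.rpow_natCast, Nat.cast_sub hm]
  nth_rewrite 2 [← Real.rpow_one (Real.sin θ)]
  rw [← Real.rpow_add hθ]
  congr 1
  push_cast
  ring

/-- Change of variables: if the angle `Θ` has density `k_m (sin θ)^(m-2)` on `[0, π]`,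
then `Y = cos Θ` has density `k_m (1 - y²)^((m-3)/2)` on `[-1, 1]`. -/
theorem pushforward_cos_density (m : ℕ) (hm : 2 ≤ m) :
    Measure.map Real.cos
      (volume.withDensity
        (Set.indicator (Set.Icc (0:ℝ) π)
          (fun θ => ENNReal.ofReal
            ((Real.Gamma ((m : ℝ) / 2) / (Real.sqrt π * Real.Gamma (((m : ℝ) - 1) / 2)))
              * Real.sin θ ^ (m - 2)))))
      = volume.withDensity
          (Set.indicator (Set.Icc (-1:ℝ) 1)
            (fun y => ENNReal.ofReal
              ((Real.Gamma ((m : ℝ) / 2) / (Real.sqrt π * Real.Gamma (((m : ℝ) - 1) / 2)))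
                * (1 - y ^ 2) ^ (((m : ℝ) - 3) / 2)))) := by
  refine map_cos_withDensity_indicator fun θ hθ => ?_
  have hsin := Real.sin_pos_of_mem_Ioo hθ
  rw [sin_pow_eq_sin_mul_rpow hm hsin, ← ENNReal.ofReal_mul hsin.le, mul_left_comm]
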